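/- Let F_i, F_j ∈ ℝ^{m×n}, G_i, G_j ∈ ℝ^m, let h ∈ ℝⁿ be a nonzero row vector, k ∈ ℝ, and ε ≥ 0. Let x, Δx ∈ ℝⁿ, ΔF_i ∈ ℝ^{m×n}, ΔG_i ∈ ℝ^m with ‖Δx‖_∞ ≤ ε. Set x̂ = x + Δx, F̂_i = F_i + ΔF_i, Ĝ_i = G_i + ΔG_i, and δ = ε(‖h‖₁ + ‖x‖₁ + nε + 1). Assume F_i z + G_i = F_j z + G_j for every z ∈ ℝⁿ with h·z = k, and |h·x − k| ≤ δ. Then ‖F̂_i x̂ + Ĝ_i − (F_j x + G_j)‖_∞ ≤ (δ/‖h‖₂²)·‖(F_i − F_j) hᵀ‖_∞ + ‖ΔF_i‖_∞ ‖x‖_∞ + ‖ΔG_i‖_∞ + ‖F̂_i‖_∞ ε, where for a matrix A, ‖A‖_∞ is the operator norm induced by the vector ∞-norm (maximum absolute row sum). -/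

import Mathlib

open Matrix BigOperators

/-- The operator norm induced by the vector `∞`-norm: the maximum absolute row sum. -/
noncomputable def matNormInf {m n : ℕ} (A : Matrix (Fin m) (Fin n) ℝ) : ℝ :=
  ‖(fun i : Fin m => ∑ j, |A i j|)‖

theorem matNormInf_nonneg {m n : ℕ} (A : Matrix (Fin m) (Fin n) ℝ) : 0 ≤ matNormInf A :=
  norm_nonneg _

theorem norm_mulVec_le_matNormInf_mul {m n : ℕ} (A : Matrix (Fin m) (Fin n) ℝ) (v : Fin n → ℝ) :
    ‖A *ᵥ v‖ ≤ matNormInf A * ‖v‖ := by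
  refine (pi_norm_le_iff_of_nonneg (mul_nonneg (matNormInf_nonneg A) (norm_nonneg v))).2 fun i => ?_
  calc ‖(A *ᵥ v) i‖ ≤ ∑ j, ‖A i j * v j‖ := norm_sum_le Finset.univ fun j => A i j * v j
    _ ≤ ∑ j, |A i j| * ‖v‖ := by
      refine Finset.sum_le_sum fun j _ => ?_
      rw [norm_mul, Real.norm_eq_abs (A i j)]
      exact mul_le_mul_of_nonneg_left (norm_le_pi_norm v j) (abs_nonneg _)
    _ = (∑ j, |A i j|) * ‖v‖ := (Finset.sum_mul _ _ _).symm
    _ ≤ matNormInf A * ‖v‖ := by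
      refine mul_le_mul_of_nonneg_right ?_ (norm_nonneg v)
      exact (le_abs_self _).trans (norm_le_pi_norm (fun i => ∑ j, |A i j|) i)

/-- Two affine maps that agree on the hyperplane `h ⬝ᵥ z = k` differ by a multiple of
`(F - F') *ᵥ h`, proportional to the signed distance to the hyperplane. -/
theorem affine_sub_eq_smul_of_agree_on_hyperplane {m n : ℕ} {F F' : Matrix (Fin m) (Fin n) ℝ}
    {G G' : Fin m → ℝ} {h : Fin n → ℝ} (hne : h ≠ 0) {k : ℝ}
    (hagree : ∀ z : Fin n → ℝ, h ⬝ᵥ z = k → F *ᵥ z + G = F' *ᵥ z + G') (x : Fin n → ℝ) :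
    (F *ᵥ x + G) - (F' *ᵥ x + G') = ((h ⬝ᵥ x - k) / (h ⬝ᵥ h)) • ((F - F') *ᵥ h) := by
  have hh : h ⬝ᵥ h ≠ 0 := fun h0 => hne (dotProduct_self_eq_zero.1 h0)
  have hz := hagree (x - ((h ⬝ᵥ x - k) / (h ⬝ᵥ h)) • h) (by
    rw [dotProduct_sub, dotProduct_smul, smul_eq_mul, div_mul_cancel₀ _ hh]
    ring)
  rw [mulVec_sub, mulVec_sub, mulVec_smul, mulVec_smul] at hz
  rw [sub_mulVec, smul_sub]
  linear_combination hz

/-- Theorem 1 with the a posteriori bound for the quantization error term. -/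
theorem quantized_empc_aposteriori_bound {m n : ℕ}
    (Fi Fj ΔFi : Matrix (Fin m) (Fin n) ℝ) (Gi Gj ΔGi : Fin m → ℝ)
    (h : Fin n → ℝ) (hne : h ≠ 0) (k ε : ℝ) (hε : 0 ≤ ε)
    (x Δx : Fin n → ℝ) (hΔx : ‖Δx‖ ≤ ε)
    (hagree : ∀ z : Fin n → ℝ, h ⬝ᵥ z = k → Fi *ᵥ z + Gi = Fj *ᵥ z + Gj)
    (hjump : |h ⬝ᵥ x - k| ≤ ε * ((∑ i, |h i|) + (∑ i, |x i|) + (n : ℝ) * ε + 1)) :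
    ‖(Fi + ΔFi) *ᵥ (x + Δx) + (Gi + ΔGi) - (Fj *ᵥ x + Gj)‖ ≤
      (ε * ((∑ i, |h i|) + (∑ i, |x i|) + (n : ℝ) * ε + 1) / (∑ i, (h i) ^ 2)) *
          ‖(Fi - Fj) *ᵥ h‖ +
        matNormInf ΔFi * ‖x‖ + ‖ΔGi‖ + matNormInf (Fi + ΔFi) * ε := by
  have hdot : h ⬝ᵥ h = ∑ i, h i ^ 2 := by simp only [dotProduct, sq]
  have hdecomp : (Fi + ΔFi) *ᵥ (x + Δx) + (Gi + ΔGi) - (Fj *ᵥ x + Gj) =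
      ((h ⬝ᵥ x - k) / ∑ i, h i ^ 2) • ((Fi - Fj) *ᵥ h) + ΔFi *ᵥ x + ΔGi +
        (Fi + ΔFi) *ᵥ Δx := by
    rw [← hdot, ← affine_sub_eq_smul_of_agree_on_hyperplane hne hagree x, mulVec_add,
      add_mulVec Fi ΔFi x]
    abel
  rw [hdecomp]
  refine norm_add_le_of_le (norm_add_le_of_le (norm_add_le_of_le ?_
    (norm_mulVec_le_matNormInf_mul ΔFi x)) le_rfl) ?_
  · have hsq : 0 ≤ ∑ i, h i ^ 2 := Finset.sum_nonneg fun i _ => sq_nonneg (h i)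
    rw [norm_smul, Real.norm_eq_abs, abs_div, abs_of_nonneg hsq]
    gcongr
  · exact (norm_mulVec_le_matNormInf_mul _ _).trans
      (mul_le_mul_of_nonneg_left hΔx (matNormInf_nonneg _))
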